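/- arXiv:0802.4294 — 2 statements merged into one kernel-verified Lean document; each statement's English description precedes it below -/
import Mathlib

section
/- Let Φ be a real-valued continuous function on the space of finite partitions (with the Rokhlin metric) that is monotone decreasing under splittings. Define φ(α) = inf_n Φ(α^n). Then φ takes the same value on all finite generating partitions; this common value is a measure-conjugacy invariant of the system. -/
open MeasureTheory Real
open scoped symmDiff ENNReal

namespace Bowen

variable {X : Type*} [MeasurableSpace X]

/-- Shannon entropy of the (countable) partition of `X` into fibers of `α`. -/
noncomputable def entropy {ι : Type*} (μ : Measure X) (α : X → ι) : ℝ :=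
  ∑' i, Real.negMulLog (μ (α ⁻¹' {i})).toReal

/-- Conditional entropy `H(α|β)` of the fiber partition of `α` given that of `β`. -/
noncomputable def condEntropy {ι κ : Type*} (μ : Measure X) (α : X → ι) (β : X → κ) : ℝ :=
  ∑' p : ι × κ,
    -((μ (α ⁻¹' {p.1} ∩ β ⁻¹' {p.2})).toReal *
      Real.log ((μ (α ⁻¹' {p.1} ∩ β ⁻¹' {p.2})).toReal / (μ (β ⁻¹' {p.2})).toReal))

/-- The Rokhlin distance `d(α,β) = H(α|β) + H(β|α)`. -/
noncomputable def rokhlin {ι κ : Type*} (μ : Measure X) (α : X → ι) (β : X → κ) : ℝ :=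
  condEntropy μ α β + condEntropy μ β α

/-- A finite measurable partition, presented as a measurable map to `ℕ` with finite range. -/
def IsFinPart (α : X → ℕ) : Prop := Measurable α ∧ (Set.range α).Finite

/-- `α` refines `β` (mod null sets): `β` factors a.e. through `α`. -/
def RefinesI {ι κ : Type*} (μ : Measure X) (α : X → ι) (β : X → κ) : Prop :=
  ∃ h : ι → κ, ∀ᵐ x ∂μ, β x = h (α x)

/-- The join `α ∨ β` of two `ℕ`-indexed partitions, encoded via `Nat.pair`. -/
def joinN (α β : X → ℕ) : X → ℕ := fun x => Nat.pair (α x) (β x)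

/-- The translated partition `gα`, with atoms `gA = {x | g⁻¹x ∈ A}` for atoms `A` of `α`. -/
def smulPart {G : Type*} [Group G] [MulAction G X] {ι : Type*} (g : G) (α : X → ι) : X → ι :=
  fun x => α (g⁻¹ • x)

/-- Join of a list of `ℕ`-indexed partitions. -/
def joinList (l : List (X → ℕ)) : X → ℕ :=
  l.foldr (fun a r x => Nat.pair (a x) (r x)) (fun _ => 0)

/-- The join `α^F = ⋁_{g ∈ F} gα` over a finite set of group elements. -/
noncomputable def joinOver {G : Type*} [Group G] [MulAction G X] (F : Finset G) (α : X → ℕ) : X → ℕ :=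
  joinList (F.toList.map (fun g => smulPart g α))

/-- The smallest `G`-invariant σ-algebra containing the partition `α`. -/
def genSA (G : Type*) [Group G] [MulAction G X] {ι : Type*} (α : X → ι) :
    MeasurableSpace X :=
  MeasurableSpace.generateFrom {s | ∃ (g : G) (i : ι), s = {x | α (g⁻¹ • x) = i}}

/-- `α` is a generating partition: every measurable set agrees mod `μ`-null sets with a set
in the smallest `G`-invariant σ-algebra containing `α`. -/
def IsGenerating (G : Type*) [Group G] [MulAction G X] {ι : Type*} (μ : Measure X)
    (α : X → ι) : Prop :=
  ∀ s : Set X, MeasurableSet s → ∃ t : Set X, MeasurableSet[genSA G α] t ∧ μ (s ∆ t) = 0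

/-- Combinatorial equivalence: `α ≤ β^L` and `β ≤ α^M` for some finite `L, M ⊆ G`. -/
def CombEquiv (G : Type*) [Group G] [MulAction G X] (μ : Measure X) (α β : X → ℕ) : Prop :=
  ∃ L M : Finset G, RefinesI μ (joinOver L β) α ∧ RefinesI μ (joinOver M α) β

/-- `α` and `β` induce the same partition mod null sets. -/
def SamePart (μ : Measure X) (α β : X → ℕ) : Prop := RefinesI μ α β ∧ RefinesI μ β α

/-- `σ` is a simple splitting of `α`: `σ = α ∨ sβ` (as partitions, mod null sets) for some
`s ∈ S` and some coarsening `β` of `α`. -/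
def SimpleSplit {G : Type*} [Group G] [MulAction G X] (μ : Measure X) (S : Finset G)
    (σ α : X → ℕ) : Prop :=
  ∃ s ∈ S, ∃ β : X → ℕ, RefinesI μ α β ∧ SamePart μ σ (joinN α (smulPart s β))

/-- `σ` is a splitting of `α`: obtained from `α` by finitely many simple splittings. -/
def IsSplitting {G : Type*} [Group G] [MulAction G X] (μ : Measure X) (S : Finset G)
    (σ α : X → ℕ) : Prop :=
  Relation.ReflTransGen (fun a b => SimpleSplit μ S b a) α σ

/-- The ball of radius `n` about the identity for the word metric of `S`:
all products of at most `n` elements of `S`. -/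
def ballF {G : Type*} [Group G] [DecidableEq G] (S : Finset G) : ℕ → Finset G
  | 0 => {1}
  | n + 1 => ballF S n ∪ (S ×ˢ ballF S n).image (fun p => p.1 * p.2)

/-- The Cayley graph of `(G,S)` (as a simple graph). -/
def cayley {G : Type*} [Group G] (S : Finset G) : SimpleGraph G :=
  SimpleGraph.fromRel (fun g h => g⁻¹ * h ∈ S)

/-- The symmetric generating set `S = {s₁^{±1},...,s_r^{±1}}` of the rank `r` free group. -/
noncomputable def genS (r : ℕ) : Finset (FreeGroup (Fin r)) :=
  letI := Classical.decEq (FreeGroup (Fin r))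
  (Finset.univ.image fun i : Fin r => FreeGroup.of i) ∪
    (Finset.univ.image fun i : Fin r => (FreeGroup.of i)⁻¹)

/-- The word-metric ball of radius `n` about `e` in the rank `r` free group. -/
noncomputable def ballFree (r : ℕ) (n : ℕ) : Finset (FreeGroup (Fin r)) :=
  letI := Classical.decEq (FreeGroup (Fin r))
  ballF (genS r) n

/-- Bowen's functional `F(α) = (1-2r)H(α) + ∑ᵢ H(α ∨ sᵢα)`. -/
noncomputable def Ffun (r : ℕ) {X : Type*} [MeasurableSpace X]
    [MulAction (FreeGroup (Fin r)) X] (μ : Measure X) (α : X → ℕ) : ℝ :=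
  (1 - 2 * (r : ℝ)) * entropy μ α +
    ∑ i : Fin r, entropy μ (joinN α (smulPart (FreeGroup.of i) α))

/-- Conditional entropy of the partition `α` relative to a sub-σ-algebra `m`:
`H(α|m) = ∫ -log μ(A_x|m)(x) dμ(x)`. -/
noncomputable def condEntropySigma (μ : Measure X) (α : X → ℕ) (m : MeasurableSpace X) : ℝ :=
  ∫ x, -Real.log ((μ[Set.indicator (α ⁻¹' {α x}) (fun _ => (1 : ℝ))|m]) x) ∂μ

end Bowen

open Bowen

namespace Bowen

section Partitions

variable {X G : Type*}

lemma joinList_cons (a : X → ℕ) (l : List (X → ℕ)) (x : X) :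
    joinList (a :: l) x = Nat.pair (a x) (joinList l x) := rfl

lemma joinList_eq_iff (l : List (X → ℕ)) (x y : X) :
    joinList l x = joinList l y ↔ ∀ a ∈ l, a x = a y := by
  induction l with
  | nil => simp [joinList]
  | cons a l ih => simp [joinList_cons, Nat.pair_eq_pair, ih]

lemma joinList_mem_of_forall_mem (A : Set ℕ) (hA : A.Finite) (n : ℕ) :
    ∃ B : Set ℕ, B.Finite ∧ ∀ l : List (X → ℕ), l.length = n →
      (∀ a ∈ l, ∀ x, a x ∈ A) → ∀ x, joinList l x ∈ B := by
  induction n with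
  | zero =>
    refine ⟨{0}, Set.finite_singleton 0, fun l hl _ x => ?_⟩
    obtain rfl := List.length_eq_zero_iff.1 hl
    rfl
  | succ n ih =>
    obtain ⟨B, hB, h⟩ := ih
    refine ⟨Set.image2 Nat.pair A B, hA.image2 _ hB, fun l hl hmem x => ?_⟩
    obtain ⟨a, t, rfl⟩ := List.exists_cons_of_length_eq_add_one hl
    rw [joinList_cons]
    refine Set.mem_image2_of_mem (hmem a (by simp) x) (h t (by simpa using hl) ?_ x)
    exact fun b hb => hmem b (by simp [hb])

variable [Group G] [MulAction G X]

lemma joinOver_eq_iff (F : Finset G) (α : X → ℕ) (x y : X) :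
    joinOver F α x = joinOver F α y ↔ ∀ g ∈ F, α (g⁻¹ • x) = α (g⁻¹ • y) := by
  simp [joinOver, joinList_eq_iff, smulPart]

lemma joinOver_mem_of_forall_mem (A : Set ℕ) (hA : A.Finite) (F : Finset G) :
    ∃ B : Set ℕ, B.Finite ∧ ∀ γ : X → ℕ, (∀ x, γ x ∈ A) → ∀ x, joinOver F γ x ∈ B := by
  obtain ⟨B, hB, h⟩ := joinList_mem_of_forall_mem (X := X) A hA F.card
  refine ⟨B, hB, fun γ hγ x => h _ (by simp) ?_ x⟩
  simp only [List.mem_map, forall_exists_index, and_imp, forall_apply_eq_imp_iff₂]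
  exact fun g _ x => hγ _

lemma joinOver_eq_of_forall_eq (F : Finset G) (α β : X → ℕ) (x : X)
    (h : ∀ g ∈ F, α (g⁻¹ • x) = β (g⁻¹ • x)) : joinOver F α x = joinOver F β x := by
  have key : ∀ l : List G, (∀ g ∈ l, α (g⁻¹ • x) = β (g⁻¹ • x)) →
      joinList (l.map fun g => smulPart g α) x = joinList (l.map fun g => smulPart g β) x := by
    intro l hl
    induction l with
    | nil => rfl
    | cons g l ih =>
      rw [List.map_cons, List.map_cons, joinList_cons, joinList_cons,
        ih fun k hk => hl k (by simp [hk])]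
      exact congrArg₂ _ (hl g (by simp)) rfl
  exact key _ (by simpa using h)

lemma factorsThrough_joinOver_of_subset {F K : Finset G} (h : F ⊆ K) (α : X → ℕ) :
    (joinOver F α).FactorsThrough (joinOver K α) := fun x y hxy => by
  rw [joinOver_eq_iff] at hxy ⊢
  exact fun g hg => hxy g (h hg)

lemma exists_preimage_joinOver_eq {F K : Finset G} (h : F ⊆ K) (α : X → ℕ) (T : Set ℕ) :
    ∃ U : Set ℕ, joinOver K α ⁻¹' U = joinOver F α ⁻¹' T := by
  refine ⟨joinOver K α '' (joinOver F α ⁻¹' T), Set.Subset.antisymm ?_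
    (Set.subset_preimage_image _ _)⟩
  rintro x ⟨y, hy, hxy⟩
  have := factorsThrough_joinOver_of_subset h α hxy
  rw [Set.mem_preimage] at hy ⊢
  rwa [← this]

lemma factorsThrough_of_one_mem {F : Finset G} (h : 1 ∈ F) (α : X → ℕ) :
    α.FactorsThrough (joinOver F α) := fun x y hxy => by
  rw [joinOver_eq_iff] at hxy
  simpa using hxy 1 h

lemma joinOver_factorsThrough_joinOver [DecidableEq G] {F K L : Finset G} {α β : X → ℕ}
    (h : α.FactorsThrough (joinOver F β)) (hL : ∀ g ∈ K, ∀ k ∈ F, g * k ∈ L) :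
    (joinOver K α).FactorsThrough (joinOver L β) := fun x y hxy => by
  rw [joinOver_eq_iff] at hxy ⊢
  refine fun g hg => h ?_
  rw [joinOver_eq_iff]
  intro k hk
  simpa [mul_smul] using hxy _ (hL g hg k hk)

section Ball

variable [DecidableEq G] (S : Finset G)

lemma ballF_mono : Monotone (ballF S) :=
  monotone_nat_of_le_succ fun _ => Finset.subset_union_left

lemma one_mem_ballF (n : ℕ) : 1 ∈ ballF S n :=
  ballF_mono S (Nat.zero_le n) (by simp [ballF])

lemma mem_ballF_succ {n : ℕ} {g : G} :
    g ∈ ballF S (n + 1) ↔ g ∈ ballF S n ∨ ∃ s ∈ S, ∃ k ∈ ballF S n, s * k = g := by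
  simp only [ballF, Finset.mem_union, Finset.mem_image, Finset.mem_product, Prod.exists]
  refine or_congr Iff.rfl ⟨?_, ?_⟩
  · rintro ⟨s, k, ⟨hs, hk⟩, rfl⟩
    exact ⟨s, hs, k, hk, rfl⟩
  · rintro ⟨s, hs, k, hk, rfl⟩
    exact ⟨s, k, ⟨hs, hk⟩, rfl⟩

lemma exists_mem_ballF {S : Finset G} (hSsymm : ∀ s ∈ S, s⁻¹ ∈ S)
    (hSgen : Subgroup.closure (S : Set G) = ⊤) (g : G) : ∃ n, g ∈ ballF S n := by
  have hg : g ∈ Subgroup.closure (S : Set G) := hSgen ▸ Subgroup.mem_top g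
  induction hg using Subgroup.closure_induction_left with
  | one => exact ⟨0, one_mem_ballF S 0⟩
  | mul_left s hs y _ ih =>
    obtain ⟨n, hn⟩ := ih
    exact ⟨n + 1, (mem_ballF_succ S).2 (Or.inr ⟨s, hs, y, hn, rfl⟩)⟩
  | inv_mul_cancel s hs y _ ih =>
    obtain ⟨n, hn⟩ := ih
    exact ⟨n + 1, (mem_ballF_succ S).2 (Or.inr ⟨s⁻¹, hSsymm s hs, y, hn, rfl⟩)⟩

lemma exists_subset_ballF {S : Finset G} (hSsymm : ∀ s ∈ S, s⁻¹ ∈ S)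
    (hSgen : Subgroup.closure (S : Set G) = ⊤) (F : Finset G) :
    ∃ n, ∀ m, n ≤ m → F ⊆ ballF S m := by
  choose r hr using exists_mem_ballF hSsymm hSgen
  exact ⟨F.sup r, fun m hm g hg => ballF_mono S ((Finset.le_sup hg).trans hm) (hr g)⟩

lemma joinOver_ballF_succ_eq_iff (c : X → ℕ) (n : ℕ) (x y : X) :
    joinOver (ballF S (n + 1)) c x = joinOver (ballF S (n + 1)) c y ↔
      joinOver (ballF S n) c x = joinOver (ballF S n) c y ∧
      ∀ s ∈ S, smulPart s (joinOver (ballF S n) c) x = smulPart s (joinOver (ballF S n) c) y := by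
  simp only [smulPart, joinOver_eq_iff, mem_ballF_succ]
  constructor
  · refine fun h => ⟨fun g hg => h g (Or.inl hg), fun s hs k hk => ?_⟩
    simpa [mul_smul] using h _ (Or.inr ⟨s, hs, k, hk, rfl⟩)
  · rintro ⟨h₁, h₂⟩ g (hg | ⟨s, hs, k, hk, rfl⟩)
    · exact h₁ g hg
    · simpa [mul_smul] using h₂ s hs k hk

end Ball

end Partitions

section Measurability

variable {X G : Type*} [MeasurableSpace X]

lemma IsFinPart.joinN {α β : X → ℕ} (hα : IsFinPart α) (hβ : IsFinPart β) :
    IsFinPart (joinN α β) := by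
  refine ⟨?_, (hα.2.image2 Nat.pair hβ.2).subset ?_⟩
  · exact (Measurable.of_discrete (f := fun p : ℕ × ℕ => Nat.pair p.1 p.2)).comp
      (hα.1.prodMk hβ.1)
  · rintro _ ⟨x, rfl⟩
    exact Set.mem_image2_of_mem ⟨x, rfl⟩ ⟨x, rfl⟩

variable [Group G] [MulAction G X]

lemma IsFinPart.smulPart (hG : ∀ g : G, Measurable fun x : X => g • x) {α : X → ℕ}
    (hα : IsFinPart α) (g : G) : IsFinPart (smulPart g α) := by
  refine ⟨hα.1.comp (hG _), hα.2.subset ?_⟩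
  rintro _ ⟨x, rfl⟩
  exact ⟨_, rfl⟩

lemma IsFinPart.joinOver (hG : ∀ g : G, Measurable fun x : X => g • x) {α : X → ℕ}
    (hα : IsFinPart α) (F : Finset G) : IsFinPart (joinOver F α) := by
  have key : ∀ l : List G, IsFinPart (joinList (l.map fun g => Bowen.smulPart g α)) := by
    intro l
    induction l with
    | nil => exact ⟨measurable_const, Set.finite_range_const⟩
    | cons g l ih => exact (hα.smulPart hG g).joinN ih
  exact key _

end Measurability

section Rokhlin

variable {X : Type*} [MeasurableSpace X] {μ : Measure X}

/-- The summand of the conditional entropy is small when the partitions rarely disagree. -/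
lemma condEntropy_term_le [IsProbabilityMeasure μ] {a b : X → ℕ} {δ η : ℝ} (hδη : δ ≤ η)
    (hη : ∀ p : ℝ, 0 ≤ p → p ≤ δ → negMulLog p ≤ η) (hab : μ.real {x | a x ≠ b x} ≤ δ)
    (i j : ℕ) :
    -((μ (a ⁻¹' {i} ∩ b ⁻¹' {j})).toReal *
      Real.log ((μ (a ⁻¹' {i} ∩ b ⁻¹' {j})).toReal / (μ (b ⁻¹' {j})).toReal)) ≤ η := by
  change -(μ.real (a ⁻¹' {i} ∩ b ⁻¹' {j}) *
      Real.log (μ.real (a ⁻¹' {i} ∩ b ⁻¹' {j}) / μ.real (b ⁻¹' {j}))) ≤ η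
  set p := μ.real (a ⁻¹' {i} ∩ b ⁻¹' {j})
  set q := μ.real (b ⁻¹' {j})
  have hpq : p ≤ q := measureReal_mono Set.inter_subset_right
  have hq1 : q ≤ 1 := measureReal_le_one
  have hD : 0 ≤ μ.real {x | a x ≠ b x} := measureReal_nonneg
  have hp0 : 0 ≤ p := measureReal_nonneg
  rcases hp0.eq_or_lt with h0 | h0
  · rw [← h0]
    simp only [zero_mul, neg_zero]
    linarith
  have hq0 : 0 < q := h0.trans_le hpq
  rcases eq_or_ne i j with rfl | hij
  · have h1 : -(p * Real.log (p / q)) ≤ q - p := by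
      rw [← mul_neg, ← Real.log_inv, inv_div]
      have := Real.log_le_sub_one_of_pos (div_pos hq0 h0)
      calc p * Real.log (q / p) ≤ p * (q / p - 1) := by gcongr
        _ = q - p := by field_simp
    have h2 : q ≤ p + μ.real {x | a x ≠ b x} := by
      refine (measureReal_mono ?_).trans (measureReal_union_le _ _)
      intro x hx
      by_cases h : a x = b x
      · exact Or.inl ⟨h.trans hx, hx⟩
      · exact Or.inr h
    linarith
  · have h1 : p ≤ δ := by
      refine (measureReal_mono ?_).trans hab
      rintro x ⟨hx, hy⟩ h
      exact hij (hx.symm.trans (h.trans hy))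
    have h2 := hη p h0.le h1
    rw [Real.log_div h0.ne' hq0.ne']
    have h3 : Real.log q ≤ 0 := Real.log_nonpos hq0.le hq1
    have h4 : p * Real.log q ≤ 0 := mul_nonpos_of_nonneg_of_nonpos h0.le h3
    simp only [negMulLog] at h2
    linarith

lemma condEntropy_le_of_term_le {a b : X → ℕ} {A B : Finset ℕ} (hA : ∀ x, a x ∈ A)
    (hB : ∀ x, b x ∈ B) {η : ℝ}
    (h : ∀ i j, -((μ (a ⁻¹' {i} ∩ b ⁻¹' {j})).toReal *
      Real.log ((μ (a ⁻¹' {i} ∩ b ⁻¹' {j})).toReal / (μ (b ⁻¹' {j})).toReal)) ≤ η) :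
    condEntropy μ a b ≤ A.card * B.card * η := by
  unfold condEntropy
  rw [tsum_eq_sum (s := A ×ˢ B)]
  · refine (Finset.sum_le_card_nsmul _ _ η fun p _ => h p.1 p.2).trans (le_of_eq ?_)
    simp [Finset.card_product]
  · rintro ⟨i, j⟩ hij
    have : a ⁻¹' {i} ∩ b ⁻¹' {j} = ∅ := by
      rw [Set.eq_empty_iff_forall_notMem]
      rintro x ⟨rfl, rfl⟩
      exact hij (Finset.mem_product.2 ⟨hA x, hB x⟩)
    simp [this]

/-- Among partitions with labels in a fixed finite set, convergence in measure implies convergence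
in the Rokhlin distance. -/
lemma exists_rokhlin_lt [IsProbabilityMeasure μ] {α : X → ℕ} (hα : (Set.range α).Finite)
    {A : Set ℕ} (hA : A.Finite) {ε : ℝ} (hε : 0 < ε) :
    ∃ δ : ℝ, 0 < δ ∧ ∀ γ : X → ℕ, (∀ x, γ x ∈ A) →
      μ.real {x | γ x ≠ α x} ≤ δ → rokhlin μ α γ < ε := by
  set B := hα.toFinset
  set C := hA.toFinset
  set M : ℝ := B.card * C.card with hM
  have hM0 : 0 ≤ M := by positivity
  set η := ε / (2 * M + 1) with hη
  have hη0 : 0 < η := by positivity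
  have hcont : Filter.Tendsto negMulLog (nhds 0) (nhds 0) := by
    simpa using Real.continuous_negMulLog.tendsto 0
  obtain ⟨δ, hδ, h⟩ := Metric.eventually_nhds_iff.1 (hcont.eventually (gt_mem_nhds hη0))
  refine ⟨min (δ / 2) η, by positivity, fun γ hγA hd => ?_⟩
  have hη' : ∀ p : ℝ, 0 ≤ p → p ≤ min (δ / 2) η → negMulLog p ≤ η := by
    intro p hp hp'
    refine (h ?_).le
    rw [Real.dist_eq, sub_zero, abs_of_nonneg hp]
    linarith [min_le_left (δ / 2) η]
  have hd' : μ.real {x | α x ≠ γ x} ≤ min (δ / 2) η := by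
    simpa only [ne_comm] using hd
  have hBmem : ∀ x, α x ∈ B := fun x => by simp [B]
  have hCmem : ∀ x, γ x ∈ C := fun x => by simpa [C] using hγA x
  have h1 := condEntropy_le_of_term_le hBmem hCmem
    (condEntropy_term_le (min_le_right _ _) hη' hd')
  have h2 := condEntropy_le_of_term_le hCmem hBmem
    (condEntropy_term_le (min_le_right _ _) hη' hd)
  have h3 : (2 * M + 1) * η = ε := by rw [hη]; field_simp
  have h4 : (C.card : ℝ) * B.card * η = M * η := by rw [hM]; ring
  unfold rokhlin
  linarith

lemma condEntropy_eq_zero {a b : X → ℕ} (h : a.FactorsThrough b) : condEntropy μ a b = 0 := by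
  unfold condEntropy
  refine (tsum_congr fun p => ?_).trans tsum_zero
  rcases (a ⁻¹' {p.1} ∩ b ⁻¹' {p.2}).eq_empty_or_nonempty with h0 | ⟨y, hy₁, hy₂⟩
  · simp [h0]
  · have : a ⁻¹' {p.1} ∩ b ⁻¹' {p.2} = b ⁻¹' {p.2} :=
      Set.inter_eq_right.2 fun x hx => (h (hx.trans hy₂.symm)).trans hy₁
    rw [this]
    rcases eq_or_ne (μ (b ⁻¹' {p.2})).toReal 0 with h0 | h0
    · simp [h0]
    · simp [div_self h0]

end Rokhlin

section Splitting

variable {X G : Type*} [MeasurableSpace X] [Group G] [MulAction G X] {μ : Measure X}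

lemma refinesI_of_factorsThrough {a b : X → ℕ} (h : b.FactorsThrough a) : RefinesI μ a b :=
  ⟨Function.extend a b fun _ => 0, .of_forall fun x => (h.extend_apply _ x).symm⟩

variable {S : Finset G} {Φ : (X → ℕ) → ℝ}

lemma eq_of_rokhlin_continuous
    (hcont : ∀ α : X → ℕ, IsFinPart α → ∀ ε : ℝ, 0 < ε → ∃ δ : ℝ, 0 < δ ∧
      ∀ β : X → ℕ, IsFinPart β → rokhlin μ α β < δ → |Φ β - Φ α| < ε)
    {a b : X → ℕ} (ha : IsFinPart a) (hb : IsFinPart b) (hab : a.FactorsThrough b)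
    (hba : b.FactorsThrough a) : Φ a = Φ b := by
  by_contra hne
  obtain ⟨δ, hδ, h⟩ := hcont b hb |Φ a - Φ b| (abs_pos.2 (sub_ne_zero.2 hne))
  refine lt_irrefl _ (h a ha ?_)
  rwa [rokhlin, condEntropy_eq_zero hab, condEntropy_eq_zero hba, add_zero]

lemma joinN_smulPart_le
    (hG : ∀ g : G, Measurable fun x : X => g • x)
    (hmono : ∀ σ α : X → ℕ, IsFinPart α → IsFinPart σ → IsSplitting μ S σ α → Φ σ ≤ Φ α)
    {a c : X → ℕ} (ha : IsFinPart a) (hc : IsFinPart c) (hca : c.FactorsThrough a)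
    {s : G} (hs : s ∈ S) : Φ (joinN a (smulPart s c)) ≤ Φ a :=
  hmono _ _ ha (ha.joinN (hc.smulPart hG s)) <| .single
    ⟨s, hs, c, refinesI_of_factorsThrough hca, ⟨id, .of_forall fun _ => rfl⟩,
      ⟨id, .of_forall fun _ => rfl⟩⟩

lemma exists_join_translates
    (hG : ∀ g : G, Measurable fun x : X => g • x)
    (hmono : ∀ σ α : X → ℕ, IsFinPart α → IsFinPart σ → IsSplitting μ S σ α → Φ σ ≤ Φ α)
    {a c : X → ℕ} (ha : IsFinPart a) (hc : IsFinPart c) (hca : c.FactorsThrough a)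
    {T : Finset G} (hT : T ⊆ S) : ∃ b : X → ℕ, IsFinPart b ∧ Φ b ≤ Φ a ∧
      ∀ x y, b x = b y ↔ a x = a y ∧ ∀ s ∈ T, smulPart s c x = smulPart s c y := by
  classical
  induction T using Finset.induction_on with
  | empty => exact ⟨a, ha, le_rfl, by simp⟩
  | insert s T _ ih =>
    obtain ⟨b, hb, hle, hbk⟩ := ih ((Finset.subset_insert s T).trans hT)
    have hcb : c.FactorsThrough b := fun x y h => hca ((hbk x y).1 h).1
    refine ⟨_, hb.joinN (hc.smulPart hG s),
      (joinN_smulPart_le hG hmono hb hc hcb (hT (Finset.mem_insert_self s T))).trans hle, ?_⟩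
    intro x y
    simp only [joinN, Nat.pair_eq_pair, hbk, Finset.mem_insert, forall_eq_or_imp]
    tauto

variable [DecidableEq G]

lemma exists_join_joinOver_ballF
    (hG : ∀ g : G, Measurable fun x : X => g • x)
    (hmono : ∀ σ α : X → ℕ, IsFinPart α → IsFinPart σ → IsSplitting μ S σ α → Φ σ ≤ Φ α)
    {a c : X → ℕ} (ha : IsFinPart a) (hc : IsFinPart c) (hca : c.FactorsThrough a) (m : ℕ) :
    ∃ b : X → ℕ, IsFinPart b ∧ Φ b ≤ Φ a ∧ ∀ x y, b x = b y ↔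
      a x = a y ∧ joinOver (ballF S m) c x = joinOver (ballF S m) c y := by
  induction m with
  | zero =>
    refine ⟨a, ha, le_rfl, fun x y => ⟨fun h => ⟨h, ?_⟩, And.left⟩⟩
    simpa [joinOver_eq_iff, ballF] using hca h
  | succ m ih =>
    obtain ⟨b, hb, hle, hbk⟩ := ih
    obtain ⟨d, hd, hdle, hdk⟩ := exists_join_translates hG hmono hb (hc.joinOver hG (ballF S m))
      (fun x y h => ((hbk x y).1 h).2) subset_rfl
    refine ⟨d, hd, hdle.trans hle, fun x y => ?_⟩
    rw [hdk, hbk, joinOver_ballF_succ_eq_iff, and_assoc]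

lemma le_of_factorsThrough
    (hG : ∀ g : G, Measurable fun x : X => g • x)
    (hcont : ∀ α : X → ℕ, IsFinPart α → ∀ ε : ℝ, 0 < ε → ∃ δ : ℝ, 0 < δ ∧
      ∀ β : X → ℕ, IsFinPart β → rokhlin μ α β < δ → |Φ β - Φ α| < ε)
    (hmono : ∀ σ α : X → ℕ, IsFinPart α → IsFinPart σ → IsSplitting μ S σ α → Φ σ ≤ Φ α)
    {a c : X → ℕ} (ha : IsFinPart a) (hc : IsFinPart c) (hca : c.FactorsThrough a) {m : ℕ}
    (hac : a.FactorsThrough (joinOver (ballF S m) c)) : Φ (joinOver (ballF S m) c) ≤ Φ a := by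
  obtain ⟨b, hb, hle, hbk⟩ := exists_join_joinOver_ballF hG hmono ha hc hca m
  rwa [eq_of_rokhlin_continuous hcont (hc.joinOver hG _) hb (fun x y h => ((hbk x y).1 h).2)
    fun x y h => (hbk x y).2 ⟨hac h, h⟩]

end Splitting

section Density

variable {X G : Type*} [MeasurableSpace X] [Group G] [MulAction G X] {μ : Measure X}
  [IsProbabilityMeasure μ]

lemma IsGenerating.exists_preimage_joinOver (hG : ∀ g : G, Measurable fun x : X => g • x)
    {α : X → ℕ} (hα : IsFinPart α) (hgen : IsGenerating G μ α) {s : Set X}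
    (hs : MeasurableSet s) {ε : ℝ} (hε : 0 < ε) :
    ∃ (F : Finset G) (T : Set ℕ), μ.real (s ∆ (joinOver F α ⁻¹' T)) ≤ ε := by
  classical
  set 𝒜 : Set (Set X) := {t | ∃ (F : Finset G) (T : Set ℕ), joinOver F α ⁻¹' T = t} with h𝒜
  have hmeas : ∀ t ∈ 𝒜, MeasurableSet t := by
    rintro _ ⟨F, T, rfl⟩
    exact (hα.joinOver hG F).1 (MeasurableSet.of_discrete)
  have halg : IsSetAlgebra 𝒜 := by
    refine ⟨⟨∅, ∅, rfl⟩, ?_, ?_⟩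
    · rintro _ ⟨F, T, rfl⟩
      exact ⟨F, Tᶜ, rfl⟩
    · rintro _ _ ⟨F, T, rfl⟩ ⟨K, V, rfl⟩
      obtain ⟨U, hU⟩ := exists_preimage_joinOver_eq (Finset.subset_union_left (s₂ := K)) α T
      obtain ⟨U', hU'⟩ := exists_preimage_joinOver_eq (Finset.subset_union_right (s₁ := F)) α V
      exact ⟨F ∪ K, U ∪ U', by rw [Set.preimage_union, hU, hU']⟩
  have hle : MeasurableSpace.generateFrom 𝒜 ≤ ‹MeasurableSpace X› :=
    MeasurableSpace.generateFrom_le hmeas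
  have hSA : genSA G α ≤ MeasurableSpace.generateFrom 𝒜 := by
    refine MeasurableSpace.generateFrom_le ?_
    rintro _ ⟨g, i, rfl⟩
    refine MeasurableSpace.measurableSet_generateFrom ⟨{g}, {Nat.pair i 0}, ?_⟩
    ext x
    simp [joinOver, joinList, smulPart, Nat.pair_eq_pair]
  obtain ⟨t, ht, hst⟩ := hgen s hs
  have hdense := @Measure.MeasureDense.of_generateFrom_isSetAlgebra_finite X
    (MeasurableSpace.generateFrom 𝒜) (μ.trim hle) 𝒜 (isFiniteMeasure_trim hle) halg rfl
  obtain ⟨_, ⟨F, T, rfl⟩, hT⟩ := @Measure.MeasureDense.approx X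
    (MeasurableSpace.generateFrom 𝒜) (μ.trim hle) 𝒜 hdense t (hSA t ht)
    (@measure_ne_top _ (_) (μ.trim hle) (isFiniteMeasure_trim hle) t) ε hε
  rw [trim_measurableSet_eq hle ((hSA t ht).symmDiff
    (MeasurableSpace.measurableSet_generateFrom ⟨F, T, rfl⟩))] at hT
  refine ⟨F, T, ENNReal.toReal_le_of_le_ofReal hε.le ?_⟩
  calc μ (s ∆ (joinOver F α ⁻¹' T)) ≤ μ (s ∆ t) + μ (t ∆ (joinOver F α ⁻¹' T)) :=
        measure_symmDiff_le _ _ _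
    _ ≤ ENNReal.ofReal ε := by rw [hst, zero_add]; exact hT.le

/-- Every finite partition is approximated by coarsenings of `α^F` when `α` is generating. -/
lemma IsGenerating.exists_approx (hG : ∀ g : G, Measurable fun x : X => g • x)
    {α β : X → ℕ} (hα : IsFinPart α) (hgen : IsGenerating G μ α) (hβ : IsFinPart β)
    {ε : ℝ} (hε : 0 < ε) :
    ∃ (F : Finset G) (f : ℕ → ℕ), (∀ n, f n ∈ insert 0 (Set.range β)) ∧
      μ.real {x | f (joinOver F α x) ≠ β x} ≤ ε := by
  classical
  set B := hβ.2.toFinset with hB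
  have hη : 0 < ε / (B.card + 1) := by positivity
  choose F T hT using fun b : ℕ => hgen.exists_preimage_joinOver hG hα
    (hβ.1 (measurableSet_singleton b)) hη
  have hsub : ∀ b ∈ B, F b ⊆ B.biUnion F := fun b hb => Finset.subset_biUnion_of_mem F hb
  choose! U hU using fun b hb => exists_preimage_joinOver_eq (hsub b hb) α (T b)
  refine ⟨B.biUnion F, fun n => if h : ∃ b ∈ B, n ∈ U b then h.choose else 0, fun n => ?_, ?_⟩
  · dsimp only
    split_ifs with h
    · exact Or.inr (by simpa [hB] using h.choose_spec.1)
    · exact Or.inl rfl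
  have hincl : {x | (fun n => if h : ∃ b ∈ B, n ∈ U b then h.choose else 0)
      (joinOver (B.biUnion F) α x) ≠ β x} ⊆
      ⋃ b ∈ B, (β ⁻¹' {b}) ∆ (joinOver (F b) α ⁻¹' T b) := by
    intro x hx
    by_contra hcon
    have hiff : ∀ b ∈ B, (β x = b ↔ joinOver (B.biUnion F) α x ∈ U b) := by
      intro b hb
      have h1 : x ∉ (β ⁻¹' {b}) ∆ (joinOver (F b) α ⁻¹' T b) := fun h =>
        hcon (Set.mem_biUnion hb h)
      rw [← hU b hb, Set.mem_symmDiff] at h1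
      simp only [Set.mem_preimage, Set.mem_singleton_iff] at h1
      tauto
    have hex : ∃ b ∈ B, joinOver (B.biUnion F) α x ∈ U b :=
      ⟨β x, by simp [hB], (hiff _ (by simp [hB])).1 rfl⟩
    refine hx ?_
    simp only [dif_pos hex]
    exact ((hiff _ hex.choose_spec.1).2 hex.choose_spec.2).symm
  calc _ ≤ _ := measureReal_mono hincl (measure_ne_top μ _)
    _ ≤ ∑ b ∈ B, μ.real ((β ⁻¹' {b}) ∆ (joinOver (F b) α ⁻¹' T b)) :=
        measureReal_biUnion_finset_le _ _
    _ ≤ B.card • (ε / (B.card + 1)) := Finset.sum_le_card_nsmul _ _ _ fun b _ => hT b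
    _ ≤ ε := by
      rw [nsmul_eq_mul, mul_div_assoc', div_le_iff₀ (by positivity)]
      nlinarith

lemma measureReal_joinOver_ne_le
    (hmp : ∀ g : G, MeasurePreserving (fun x : X => g • x) μ μ) {a b : X → ℕ}
    (ha : Measurable a) (hb : Measurable b) (F : Finset G) :
    μ.real {x | joinOver F a x ≠ joinOver F b x} ≤ F.card * μ.real {x | a x ≠ b x} := by
  have hmeas : MeasurableSet {x | a x ≠ b x} := (measurableSet_eq_fun ha hb).compl
  have hincl : {x | joinOver F a x ≠ joinOver F b x} ⊆
      ⋃ g ∈ F, (fun x : X => g⁻¹ • x) ⁻¹' {x | a x ≠ b x} := by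
    intro x hx
    by_contra hcon
    refine hx (joinOver_eq_of_forall_eq F a b x fun g hg => ?_)
    by_contra hne
    exact hcon (Set.mem_biUnion hg hne)
  calc _ ≤ _ := measureReal_mono hincl (measure_ne_top μ _)
    _ ≤ ∑ g ∈ F, μ.real ((fun x : X => g⁻¹ • x) ⁻¹' {x | a x ≠ b x}) :=
        measureReal_biUnion_finset_le _ _
    _ = F.card * μ.real {x | a x ≠ b x} := by
      rw [Finset.sum_congr rfl fun g _ =>
        (hmp g⁻¹).measureReal_preimage hmeas.nullMeasurableSet, Finset.sum_const, nsmul_eq_mul]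

/-- The combinatorial equivalence class of a finite generating partition `α` is dense in the
space of finite generating partitions. -/
lemma exists_combEquiv_approx [DecidableEq G]
    (hmp : ∀ g : G, MeasurePreserving (fun x : X => g • x) μ μ) {α β : X → ℕ}
    (hα : IsFinPart α) (hβ : IsFinPart β) (hgenα : IsGenerating G μ α)
    (hgenβ : IsGenerating G μ β) :
    ∃ A : Set ℕ, A.Finite ∧ ∀ δ : ℝ, 0 < δ → ∃ γ : X → ℕ, Measurable γ ∧ (∀ x, γ x ∈ A) ∧
      μ.real {x | γ x ≠ β x} ≤ δ ∧ ∃ L M : Finset G,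
        γ.FactorsThrough (joinOver L α) ∧ α.FactorsThrough (joinOver M γ) := by
  classical
  have hG : ∀ g : G, Measurable fun x : X => g • x := fun g => (hmp g).measurable
  set R : Set ℕ := insert 0 (Set.range β) with hR
  have hRfin : R.Finite := hβ.2.insert 0
  obtain ⟨N, hN⟩ := hRfin.bddAbove
  refine ⟨R ∪ Set.image2 (fun r i => N + 1 + Nat.pair r i) R (Set.range α),
    hRfin.union (hRfin.image2 _ hα.2), fun δ hδ => ?_⟩
  obtain ⟨M, f, -, hf⟩ := hgenβ.exists_approx hG hβ hα (half_pos hδ)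
  have hη : 0 < δ / 2 / (M.card + 1) := by positivity
  obtain ⟨L, k, hk, hkβ⟩ := hgenα.exists_approx hG hα hβ hη
  set c : X → ℕ := fun x => k (joinOver L α x) with hc
  have hcm : Measurable c := measurable_from_top.comp (hα.joinOver hG L).1
  have hcfin : IsFinPart c := ⟨hcm, hRfin.subset (by rintro _ ⟨x, rfl⟩; exact hk _)⟩
  have hcN : ∀ x, c x < N + 1 := fun x => Nat.lt_succ_of_le (hN (hk _))
  set e : X → ℕ := fun x => f (joinOver M c x) with he
  have hem : Measurable e := measurable_from_top.comp (hcfin.joinOver hG M).1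
  set γ : X → ℕ := fun x => if e x = α x then c x else N + 1 + Nat.pair (c x) (α x) with hγ
  have hcγ : c.FactorsThrough γ := by
    intro x y hxy
    have hx := hcN x
    have hy := hcN y
    simp only [hγ] at hxy
    split_ifs at hxy
    · exact hxy
    · omega
    · omega
    · exact (Nat.pair_eq_pair.1 (Nat.add_left_cancel hxy)).1
  refine ⟨γ, ?_, fun x => ?_, ?_, ?_⟩
  · refine Measurable.ite (measurableSet_eq_fun hem hα.1) hcm ?_
    exact (measurable_from_top (f := fun n => N + 1 + n)).comp (hcfin.joinN hα).1
  · simp only [hγ]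
    split_ifs
    · exact Or.inl (hk _)
    · exact Or.inr (Set.mem_image2_of_mem (hk _) ⟨x, rfl⟩)
  · have hincl : {x | γ x ≠ β x} ⊆ {x | c x ≠ β x} ∪
        ({x | joinOver M c x ≠ joinOver M β x} ∪ {x | f (joinOver M β x) ≠ α x}) := by
      intro x hx
      by_contra hcon
      simp only [Set.mem_union, Set.mem_ofPred_eq, not_or, not_not] at hcon
      obtain ⟨h1, h2, h3⟩ := hcon
      refine hx ?_
      have : e x = α x := by simp only [he, h2, h3]
      simp only [hγ, this, if_true, h1]
    have h1 := (measureReal_mono (μ := μ) hincl).trans ((measureReal_union_le _ _).trans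
      (add_le_add_right (measureReal_union_le _ _) _))
    have h2 := measureReal_joinOver_ne_le hmp hcm hβ.1 M
    have h3 : (M.card : ℝ) * μ.real {x | c x ≠ β x} ≤ M.card * (δ / 2 / (M.card + 1)) := by
      gcongr
    have h4 : (M.card + 1 : ℝ) * (δ / 2 / (M.card + 1)) = δ / 2 := by field_simp
    have h5 : μ.real {x | c x ≠ β x} ≤ δ / 2 / (M.card + 1) := hkβ
    linarith
  · refine ⟨insert 1 (L ∪ M.biUnion fun g => L.image fun l => g * l), insert 1 M, ?_, ?_⟩
    · have hcL : c.FactorsThrough (joinOver L α) := fun x y h => congrArg k h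
      intro x y hxy
      have h1 : α x = α y := factorsThrough_of_one_mem (Finset.mem_insert_self _ _) α hxy
      have h2 : c x = c y := hcL (factorsThrough_joinOver_of_subset
        (Finset.subset_union_left.trans (Finset.subset_insert _ _)) α hxy)
      have h3 : joinOver M c x = joinOver M c y := by
        refine joinOver_factorsThrough_joinOver hcL (fun g hg l hl => ?_) hxy
        exact Finset.mem_insert_of_mem (Finset.mem_union_right _
          (Finset.mem_biUnion.2 ⟨g, hg, Finset.mem_image_of_mem _ hl⟩))
      simp only [hγ, he, h1, h2, h3]
    · intro x y hxy
      have h1 : γ x = γ y := factorsThrough_of_one_mem (Finset.mem_insert_self _ _) γ hxy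
      have h2 : joinOver M c x = joinOver M c y := by
        rw [joinOver_eq_iff] at hxy ⊢
        exact fun g hg => hcγ (hxy g (Finset.mem_insert_of_mem hg))
      have hx := hcN x
      have hy := hcN y
      have h3 : e x = e y := congrArg f h2
      simp only [hγ] at h1
      split_ifs at h1 with h4 h5 h5
      · exact h4.symm.trans (h3.trans h5)
      · omega
      · omega
      · exact (Nat.pair_eq_pair.1 (Nat.add_left_cancel h1)).2

end Density

lemma iInf_joinOver_ballF_le {X : Type*} [MeasurableSpace X] {G : Type*}
    [Group G] [DecidableEq G] [MulAction G X] {μ : Measure X} [IsProbabilityMeasure μ]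
    (hmp : ∀ g : G, MeasurePreserving (fun x : X => g • x) μ μ)
    {S : Finset G} (hSsymm : ∀ s ∈ S, s⁻¹ ∈ S)
    (hSgen : Subgroup.closure (S : Set G) = ⊤)
    {Φ : (X → ℕ) → ℝ}
    (hcont : ∀ α : X → ℕ, IsFinPart α → ∀ ε : ℝ, 0 < ε → ∃ δ : ℝ, 0 < δ ∧
      ∀ β : X → ℕ, IsFinPart β → rokhlin μ α β < δ → |Φ β - Φ α| < ε)
    (hmono : ∀ σ α : X → ℕ, IsFinPart α → IsFinPart σ → IsSplitting μ S σ α → Φ σ ≤ Φ α)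
    {α β : X → ℕ} (hα : IsFinPart α) (hβ : IsFinPart β)
    (hgenα : IsGenerating G μ α) (hgenβ : IsGenerating G μ β) :
    (⨅ n : ℕ, (Φ (joinOver (ballF S n) α) : EReal))
      ≤ ⨅ n : ℕ, (Φ (joinOver (ballF S n) β) : EReal) := by
  have hG : ∀ g : G, Measurable fun x : X => g • x := fun g => (hmp g).measurable
  refine le_iInf fun n => le_of_forall_gt_imp_ge_of_dense fun r hr => ?_
  obtain ⟨t, ht, htr⟩ := EReal.lt_iff_exists_real_btwn.1 hr
  refine le_trans ?_ htr.le
  obtain ⟨δ, hδ, hclose⟩ := hcont (joinOver (ballF S n) β) (hβ.joinOver hG _)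
    (t - Φ (joinOver (ballF S n) β)) (sub_pos.2 (EReal.coe_lt_coe_iff.1 ht))
  obtain ⟨A, hA, happrox⟩ := exists_combEquiv_approx hmp hα hβ hgenα hgenβ
  obtain ⟨B, hB, hAB⟩ := joinOver_mem_of_forall_mem (X := X) A hA (ballF S n)
  obtain ⟨η, hη, hrok⟩ := exists_rokhlin_lt (μ := μ) (hβ.joinOver hG (ballF S n)).2 hB hδ
  obtain ⟨γ, hγm, hγA, hγβ, L, M, hL, hM⟩ := happrox (η / ((ballF S n).card + 1)) (by positivity)
  have hγ : IsFinPart γ := ⟨hγm, hA.subset (by rintro _ ⟨x, rfl⟩; exact hγA x)⟩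
  have hdist : μ.real {x | joinOver (ballF S n) γ x ≠ joinOver (ballF S n) β x} ≤ η := by
    refine (measureReal_joinOver_ne_le hmp hγm hβ.1 _).trans ?_
    calc _ ≤ ((ballF S n).card : ℝ) * (η / ((ballF S n).card + 1)) := by gcongr
      _ ≤ η := by
        rw [mul_div_assoc', div_le_iff₀ (by positivity)]
        nlinarith
  have h1 : Φ (joinOver (ballF S n) γ) < t := by
    have := hclose _ (hγ.joinOver hG _) (hrok _ (hAB γ hγA) hdist)
    linarith [(abs_lt.1 this).2]
  obtain ⟨j, hj⟩ := exists_subset_ballF hSsymm hSgen M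
  set p := max j n
  have h2 : Φ (joinOver (ballF S p) γ) ≤ Φ (joinOver (ballF S n) γ) :=
    le_of_factorsThrough hG hcont hmono (hγ.joinOver hG _) hγ
      (factorsThrough_of_one_mem (one_mem_ballF S n) γ)
      (factorsThrough_joinOver_of_subset (ballF_mono S (le_max_right j n)) γ)
  obtain ⟨m, hm⟩ := exists_subset_ballF hSsymm hSgen
    ((ballF S p ×ˢ L).image fun q => q.1 * q.2)
  have h3 : Φ (joinOver (ballF S m) α) ≤ Φ (joinOver (ballF S p) γ) := by
    refine le_of_factorsThrough hG hcont hmono (hγ.joinOver hG _) hα ?_ ?_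
    · exact fun x y h => hM (factorsThrough_joinOver_of_subset (hj p (le_max_left j n)) γ h)
    · refine joinOver_factorsThrough_joinOver hL fun g hg l hl => hm m le_rfl ?_
      exact Finset.mem_image.2 ⟨(g, l), Finset.mem_product.2 ⟨hg, hl⟩, rfl⟩
  exact (iInf_le _ m).trans (EReal.coe_le_coe_iff.2 (h3.trans (h2.trans h1.le)))

end Bowen

/-- Theorem 4.3: if `Φ` is continuous for the Rokhlin metric and monotone
decreasing under splittings, then `φ(α) = inf_n Φ(α^n)` takes the same value on every
finite generating partition (hence defines a measure-conjugacy invariant). -/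
theorem monotone_functional_invariant {X : Type*} [MeasurableSpace X] {G : Type*}
    [Group G] [DecidableEq G] [MulAction G X] (μ : Measure X) [IsProbabilityMeasure μ]
    (hmp : ∀ g : G, MeasurePreserving (fun x : X => g • x) μ μ)
    (S : Finset G) (hSsymm : ∀ s ∈ S, s⁻¹ ∈ S)
    (hSgen : Subgroup.closure (S : Set G) = ⊤)
    (Φ : (X → ℕ) → ℝ)
    (hcont : ∀ α : X → ℕ, IsFinPart α → ∀ ε : ℝ, 0 < ε → ∃ δ : ℝ, 0 < δ ∧
      ∀ β : X → ℕ, IsFinPart β → rokhlin μ α β < δ → |Φ β - Φ α| < ε)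
    (hmono : ∀ σ α : X → ℕ, IsFinPart α → IsFinPart σ → IsSplitting μ S σ α → Φ σ ≤ Φ α)
    (α β : X → ℕ) (hα : IsFinPart α) (hβ : IsFinPart β)
    (hgenα : IsGenerating G μ α) (hgenβ : IsGenerating G μ β) :
    (⨅ n : ℕ, (Φ (joinOver (ballF S n) α) : EReal))
      = ⨅ n : ℕ, (Φ (joinOver (ballF S n) β) : EReal) := by
  exact le_antisymm
    (iInf_joinOver_ballF_le hmp hSsymm hSgen hcont hmono hα hβ hgenα hgenβ)
    (iInf_joinOver_ballF_le hmp hSsymm hSgen hcont hmono hβ hα hgenβ hgenα)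
end

section
/- Let G be a finitely generated free group. If (K₁,κ₁) and (K₂,κ₂) are finite probability spaces, then the Bernoulli shifts (G, K₁^G, κ₁^G) and (G, K₂^G, κ₂^G) are measurably conjugate only if H(κ₁) = H(κ₂). -/
open MeasureTheory
open scoped ENNReal

namespace Bowen

/-- The Bernoulli shift action: `(g • x)(f) = x(g⁻¹ f)`. -/
def shift {G : Type*} [Group G] {K : Type*} (g : G) (x : G → K) : G → K :=
  fun f => x (g⁻¹ * f)

/-- Measurable conjugacy of two Bernoulli shifts over `G`: an equivariant measure
isomorphism (mod null sets). -/
def MeasConj {G : Type*} [Group G] {K₁ K₂ : Type*} [MeasurableSpace K₁]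
    [MeasurableSpace K₂] (μ₁ : Measure (G → K₁)) (μ₂ : Measure (G → K₂)) : Prop :=
  ∃ (φ : (G → K₁) → (G → K₂)) (ψ : (G → K₂) → (G → K₁)),
    Measurable φ ∧ Measurable ψ ∧ Measure.map φ μ₁ = μ₂ ∧
    (∀ᵐ x ∂μ₁, ψ (φ x) = x) ∧ (∀ᵐ y ∂μ₂, φ (ψ y) = y) ∧
    (∀ g : G, ∀ᵐ x ∂μ₁, φ (shift g x) = shift g (φ x))


lemma sum_mul_comp_eq {Ω A : Type*} [Fintype Ω] [Fintype A] [DecidableEq A]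
    {p : Ω → ℝ} {T : Ω → A} {q : A → ℝ} (hq : ∀ a, ∑ x with T x = a, p x = q a) (h : A → ℝ) :
    ∑ x, p x * h (T x) = ∑ a, q a * h a := by
  rw [← Finset.sum_fiberwise (g := T)]
  refine Finset.sum_congr rfl fun a _ => ?_
  rw [← hq a, Finset.sum_mul]
  refine Finset.sum_congr rfl fun x hx => ?_
  rw [(Finset.mem_filter.1 hx).2]

/-- If independent variables `S v` with common law `r` can be recovered from the variables `T v`
with common law `q`, then the entropy of `r` is at most that of `q`. -/
theorem sum_negMulLog_le_of_injective {Ω V A B : Type*} [Fintype Ω] [Fintype V] [Nonempty V]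
    [Fintype A] [Fintype B] [DecidableEq A] [DecidableEq B]
    {p : Ω → ℝ} (hp0 : ∀ x, 0 ≤ p x) (hp1 : ∑ x, p x = 1)
    {S : V → Ω → B} {T : V → Ω → A} {r : B → ℝ} {q : A → ℝ}
    (hr : ∀ v b, ∑ x with S v x = b, p x = r b) (hq : ∀ v a, ∑ x with T v x = a, p x = q a)
    (hprod : ∀ x, p x = ∏ v, r (S v x)) (hinj : Function.Injective fun x v => T v x) :
    ∑ b, (r b).negMulLog ≤ ∑ a, (q a).negMulLog := by
  classical
  obtain ⟨v₀⟩ := ‹Nonempty V›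
  have hq0 : ∀ a, 0 ≤ q a := fun a => hq v₀ a ▸ Finset.sum_nonneg fun x _ => hp0 x
  have hq1 : ∑ a, q a = 1 := by
    simpa [hp1] using (sum_mul_comp_eq (hq v₀) fun _ => 1).symm
  have hpq : ∀ x v, p x ≤ q (T v x) := fun x v => by
    rw [← hq v]
    exact Finset.single_le_sum (f := p) (fun x _ => hp0 x) (by simp)
  have hpr : ∀ x v, p x ≤ r (S v x) := fun x v => by
    rw [← hr v]
    exact Finset.single_le_sum (f := p) (fun x _ => hp0 x) (by simp)
  have hQ : ∑ x, ∏ v, q (T v x) ≤ 1 := by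
    calc ∑ x, ∏ v, q (T v x)
        = ∑ z ∈ Finset.univ.map ⟨fun x v => T v x, hinj⟩, ∏ v, q (z v) := by simp
      _ ≤ ∑ z : V → A, ∏ v, q (z v) :=
          Finset.sum_le_sum_of_subset_of_nonneg (Finset.subset_univ _)
            fun z _ _ => Finset.prod_nonneg fun v _ => hq0 _
      _ = ∏ _v : V, ∑ a, q a := by
          rw [Finset.prod_univ_sum, Fintype.piFinset_univ]
      _ = 1 := by simp [hq1]
  have key : ∀ x, -∑ v, p x * Real.log (r (S v x)) ≤
      -∑ v, p x * Real.log (q (T v x)) + ∏ v, q (T v x) - p x := by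
    intro x
    rcases (hp0 x).eq_or_lt with h | h
    · simpa [← h] using Finset.prod_nonneg fun v _ => hq0 (T v x)
    · rw [← Finset.mul_sum, ← Finset.mul_sum,
        ← Real.log_prod fun v _ => (h.trans_le (hpr x v)).ne', ← hprod,
        ← Real.log_prod fun v _ => (h.trans_le (hpq x v)).ne']
      have hQ0 : 0 < ∏ v, q (T v x) := Finset.prod_pos fun v _ => h.trans_le (hpq x v)
      have h1 := Real.log_le_sub_one_of_pos (div_pos hQ0 h)
      rw [Real.log_div hQ0.ne' h.ne'] at h1
      have h2 := mul_le_mul_of_nonneg_left h1 h.le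
      have h3 : p x * ((∏ v, q (T v x)) / p x) = ∏ v, q (T v x) := by field_simp
      rw [mul_sub, mul_sub, h3] at h2
      linarith
  have hsum := Finset.sum_le_sum fun x (_ : x ∈ Finset.univ) => key x
  rw [Finset.sum_sub_distrib, Finset.sum_add_distrib, Finset.sum_neg_distrib,
    Finset.sum_neg_distrib, Finset.sum_comm, hp1, Finset.sum_comm (γ := Ω)] at hsum
  simp_rw [fun v => sum_mul_comp_eq (hr v) fun b => Real.log (r b),
    fun v => sum_mul_comp_eq (hq v) fun a => Real.log (q a), Finset.sum_const,
    Finset.card_univ, nsmul_eq_mul] at hsum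
  have hV : (0 : ℝ) < Fintype.card V := by exact_mod_cast Fintype.card_pos
  refine le_of_mul_le_mul_left ?_ hV
  simp only [Real.negMulLog, neg_mul, Finset.sum_neg_distrib]
  linarith

/-- Free groups are residually finite: any finite subset is mapped injectively by some
homomorphism to a finite permutation group. -/
theorem exists_perm_hom_injOn_freeGroup {α : Type*} (S : Finset (FreeGroup α)) :
    ∃ (B : Finset (FreeGroup α)) (π : FreeGroup α →* Equiv.Perm B), Set.InjOn π S := by
  classical
  let B : Finset (FreeGroup α) := (S ×ˢ S).biUnion fun st =>
    ((st.1⁻¹ * st.2).toWord.tails.map FreeGroup.mk).toFinset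
  have hσ : ∀ i : α, ∃ σ : Equiv.Perm B, ∀ b : B, ∀ h : FreeGroup.of i * b ∈ B,
      σ b = ⟨FreeGroup.of i * b, h⟩ := by
    intro i
    obtain ⟨σ, hσ⟩ := Equiv.Perm.exists_extending_pair
      (fun b : {b : B // FreeGroup.of i * b ∈ B} => (b.1 : B))
      (fun b => (⟨FreeGroup.of i * b.1.1, b.2⟩ : B)) Subtype.val_injective
      (fun b c h => Subtype.ext (Subtype.ext (mul_left_cancel (congrArg Subtype.val h))))
    exact ⟨σ, fun b h => hσ ⟨b, h⟩⟩
  choose σ hσ using hσ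
  have hlift : ∀ L : List (α × Bool), ∀ h : (∀ T, T <:+ L → FreeGroup.mk T ∈ B),
      (FreeGroup.lift σ (FreeGroup.mk L) ⟨1, h [] L.nil_suffix⟩ : FreeGroup α)
        = FreeGroup.mk L := by
    intro L
    induction L with
    | nil =>
      intro h
      simp [← FreeGroup.one_eq_mk]
    | cons a L ih =>
      intro h
      obtain ⟨i, s⟩ := a
      have hL := ih fun T hT => h T (hT.trans (L.suffix_cons _))
      replace hL := Subtype.ext (a2 := ⟨FreeGroup.mk L, h _ (L.suffix_cons _)⟩) hL
      have hmem := h _ (List.suffix_refl _)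
      have hmk : FreeGroup.mk ((i, s) :: L) = FreeGroup.mk [(i, s)] * FreeGroup.mk L := by
        simp [FreeGroup.mul_mk]
      simp only [hmk] at hmem ⊢
      rw [map_mul, Equiv.Perm.mul_apply, hL]
      cases s with
      | true =>
        have := hσ i ⟨FreeGroup.mk L, h _ (L.suffix_cons _)⟩ hmem
        simpa [FreeGroup.lift_mk, FreeGroup.of, FreeGroup.mul_mk] using congrArg Subtype.val this
      | false =>
        have hinv : FreeGroup.mk [(i, false)] = (FreeGroup.of i)⁻¹ := by
          simp [FreeGroup.of, FreeGroup.inv_mk, FreeGroup.invRev]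
        simp only [hinv] at hmem ⊢
        rw [map_inv, FreeGroup.lift_apply_of]
        have hm : FreeGroup.mk L ∈ B := h _ (L.suffix_cons _)
        have := hσ i ⟨_, hmem⟩ (by simpa using hm)
        have hinv' : (σ i)⁻¹ ⟨FreeGroup.mk L, hm⟩ = ⟨_, hmem⟩ := by
          rw [Equiv.Perm.inv_eq_iff_eq, this]
          simp
        rw [hinv']
  refine ⟨B, FreeGroup.lift σ, fun s hs t ht hst => ?_⟩
  have hB : ∀ T, T <:+ (s⁻¹ * t).toWord → FreeGroup.mk T ∈ B := fun T hT =>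
    Finset.mem_biUnion.2 ⟨(s, t), Finset.mem_product.2 ⟨hs, ht⟩, by
      rw [List.mem_toFinset]
      exact List.mem_map_of_mem ((List.mem_tails _ _).2 hT)⟩
  have h := hlift _ hB
  simp only [FreeGroup.mk_toWord, map_mul, map_inv, hst, inv_mul_cancel] at h
  exact inv_mul_eq_one.1 h.symm

section
variable {ι K : Type*} [MeasurableSpace K]

/-- The coordinates in `W` are independent with law `κ` under `μ`, expressed on cylinder sets. -/
def HasProductMarginal (κ : Measure K) (μ : Measure (ι → K)) (W : Finset ι) : Prop :=
  ∀ y : ι → K, μ {x | ∀ i ∈ W, x i = y i} = ∏ i ∈ W, κ {y i}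

lemma map_restrict_apply_singleton [MeasurableSingletonClass K] (μ : Measure (ι → K)) (W : Finset ι) (y : ι → K) :
    μ.map W.restrict {W.restrict y} = μ {x | ∀ i ∈ W, x i = y i} := by
  rw [Measure.map_apply (by fun_prop) (measurableSet_singleton _)]
  congr 1
  ext x
  simp [funext_iff]

namespace HasProductMarginal
variable {κ : Measure K} {μ ν : Measure (ι → K)} {W : Finset ι}

lemma isProbabilityMeasure [Nonempty K] (hμ : HasProductMarginal κ μ ∅) :
    IsProbabilityMeasure μ :=
  ⟨by simpa using hμ fun _ => Classical.arbitrary K⟩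

lemma pi [Fintype ι] (κ : Measure K) [IsProbabilityMeasure κ] (W : Finset ι) :
    HasProductMarginal κ (Measure.pi fun _ => κ) W := by
  intro y
  rw [← Measure.pi_pi_finset (fun _ => κ) (fun i => {y i}) W]
  rfl

variable [MeasurableSingletonClass K]

lemma map_comp {J : Type*} [DecidableEq ι] [Nonempty K] {S : Finset J} {e : J → ι}
    (he : Set.InjOn e S) (hμ : HasProductMarginal κ μ (S.image e)) :
    HasProductMarginal κ (μ.map fun x j => x (e j)) S := by
  intro y
  have hm : MeasurableSet {x : J → K | ∀ i ∈ S, x i = y i} := by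
    have : {x : J → K | ∀ i ∈ S, x i = y i} = (S.restrict : (J → K) → S → K) ⁻¹' {S.restrict y} := by
      ext x; simp [funext_iff]
    rw [this]
    exact Finset.measurable_restrict S (measurableSet_singleton _)
  rw [Measure.map_apply (by fun_prop) hm]
  rcases isEmpty_or_nonempty J with hJ | hJ
  · have hS : S = ∅ := Finset.eq_empty_of_isEmpty S
    subst hS
    simpa using hμ fun _ => Classical.arbitrary K
  · have h := hμ fun i => y (Function.invFunOn e S i)
    rw [Finset.prod_image he] at h
    have hy : ∏ j ∈ S, κ {y j} = ∏ j ∈ S, κ {y (Function.invFunOn e S (e j))} :=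
      Finset.prod_congr rfl fun j hj => by rw [he.leftInvOn_invFunOn hj]
    rw [hy, ← h]
    congr 1
    ext x
    simp only [Set.mem_preimage, Set.mem_ofPred_eq, Finset.forall_mem_image]
    exact forall₂_congr fun j hj => by rw [he.leftInvOn_invFunOn hj]

variable [Fintype K]

lemma map_restrict_eq [Nonempty K] (hμ : HasProductMarginal κ μ W)
    (hν : HasProductMarginal κ ν W) : μ.map W.restrict = ν.map W.restrict := by
  classical
  refine Measure.ext_of_singleton fun z => ?_
  obtain ⟨y, rfl⟩ : ∃ y : ι → K, W.restrict y = z :=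
    ⟨fun i => if h : i ∈ W then z ⟨i, h⟩ else Classical.arbitrary K, by ext i; simp⟩
  rw [map_restrict_apply_singleton, map_restrict_apply_singleton, hμ, hν]

lemma measurableSet_of_dependsOn {A : Type*} {Z : (ι → K) → A} (hZ : DependsOn Z W) (a : A) :
    MeasurableSet {x | Z x = a} := by
  have : {x | Z x = a} = W.restrict ⁻¹' (W.restrict '' {x | Z x = a}) := by
    refine (Set.subset_preimage_image _ _).antisymm ?_
    rintro x ⟨y, hy, hyx⟩
    exact (hZ fun i hi => congrFun hyx.symm ⟨i, hi⟩).trans hy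
  rw [this]
  exact (Finset.measurable_restrict W) (Set.toFinite _).measurableSet

lemma measure_eq [Nonempty K] (hμ : HasProductMarginal κ μ W) (hν : HasProductMarginal κ ν W)
    {A : Type*} {Z : (ι → K) → A} (hZ : DependsOn Z W) (a : A) :
    μ {x | Z x = a} = ν {x | Z x = a} := by
  have : {x | Z x = a} = W.restrict ⁻¹' (W.restrict '' {x | Z x = a}) := by
    refine (Set.subset_preimage_image _ _).antisymm ?_
    rintro x ⟨y, hy, hyx⟩
    exact (hZ fun i hi => congrFun hyx.symm ⟨i, hi⟩).trans hy
  rw [this, ← Measure.map_apply (Finset.measurable_restrict W) (Set.toFinite _).measurableSet,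
    ← Measure.map_apply (Finset.measurable_restrict W) (Set.toFinite _).measurableSet,
    map_restrict_eq hμ hν]

lemma measure_eq_measure [Nonempty K] (hμ : ∀ W, HasProductMarginal κ μ W)
    (hν : ∀ W, HasProductMarginal κ ν W) : μ = ν := by
  have := (hμ ∅).isProbabilityMeasure
  have (W : Finset ι) : IsProbabilityMeasure (μ.map W.restrict) :=
    Measure.isProbabilityMeasure_map (by fun_prop)
  exact IsProjectiveLimit.unique (P := fun W : Finset ι => μ.map W.restrict) (fun _ => rfl)
    fun W => map_restrict_eq (hν W) (hμ W)

end HasProductMarginal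

/-- A measurable map from a product space to a finite set agrees, outside a set of small measure,
with a map depending on finitely many coordinates. -/
theorem exists_dependsOn_measure_ne_le [Fintype K] [MeasurableSingletonClass K]
    {L : Type*} [Fintype L] [Nonempty L] [MeasurableSpace L]
    [MeasurableSingletonClass L] (μ : Measure (ι → K)) [IsFiniteMeasure μ] {f : (ι → K) → L}
    (hf : Measurable f) {ε : ℝ} (hε : 0 < ε) :
    ∃ (W : Finset ι) (a : (ι → K) → L), DependsOn a W ∧ Measurable a ∧
      μ {x | a x ≠ f x} ≤ ENNReal.ofReal ε := by
  classical
  have hdense : μ.MeasureDense (measurableCylinders fun _ : ι => K) :=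
    .of_generateFrom_isSetAlgebra_finite μ isSetAlgebra_measurableCylinders
      generateFrom_measurableCylinders.symm
  have hL : (0 : ℝ) < Fintype.card L := by exact_mod_cast Fintype.card_pos
  have happ := fun l : L => hdense.approx (f ⁻¹' {l}) (hf (measurableSet_singleton l))
    (measure_ne_top _ _) (ε / Fintype.card L) (by positivity)
  choose C hC hCμ using happ
  simp only [mem_measurableCylinders] at hC
  choose s D hD hCD using hC
  let a : (ι → K) → L := fun x =>
    if h : ∃ l, x ∈ C l then h.choose else Classical.arbitrary L
  have ha : DependsOn a (Finset.univ.biUnion s : Finset ι) := by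
    intro x y hxy
    have : ∀ l, x ∈ C l ↔ y ∈ C l := fun l => by
      have : (s l).restrict x = (s l).restrict y := by
        ext ⟨i, hi⟩
        exact hxy i (by simpa using ⟨l, hi⟩)
      rw [hCD l, mem_cylinder, mem_cylinder, this]
    simp only [a, this]
  refine ⟨_, a, ha, measurable_to_countable' fun l =>
    HasProductMarginal.measurableSet_of_dependsOn ha l, ?_⟩
  have hsub : {x | a x ≠ f x} ⊆ ⋃ l, symmDiff (f ⁻¹' {l}) (C l) := by
    intro x hx
    by_contra hcon
    simp only [Set.mem_iUnion, Set.mem_symmDiff, Set.mem_preimage, Set.mem_singleton_iff,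
      not_exists] at hcon
    have hiff : ∀ l, x ∈ C l ↔ f x = l := fun l => by
      have := hcon l
      tauto
    have hex : ∃ l, x ∈ C l := ⟨f x, (hiff _).2 rfl⟩
    refine hx ?_
    simp only [a, dif_pos hex]
    exact ((hiff _).1 hex.choose_spec).symm
  calc μ {x | a x ≠ f x} ≤ ∑ l, μ (symmDiff (f ⁻¹' {l}) (C l)) :=
        (measure_mono hsub).trans (measure_iUnion_fintype_le _ _)
    _ ≤ ∑ _l : L, ENNReal.ofReal (ε / Fintype.card L) :=
        Finset.sum_le_sum fun l _ => (hCμ l).le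
    _ = ENNReal.ofReal ε := by
        rw [Finset.sum_const, Finset.card_univ, nsmul_eq_mul, ← ENNReal.ofReal_natCast,
          ← ENNReal.ofReal_mul hL.le]
        congr 1
        field_simp

end

section

variable {G K L : Type*} [Group G]

/-- The pair formed by the symbol at `1` of the image of `x` under the block code `a`, and a
correction symbol which recovers `x 1` where decoding by `b` fails. -/
noncomputable def correctedCode [DecidableEq K] (a : (G → K) → L) (b : (G → L) → K) (x : G → K) :
    L × Option K :=
  (a x, if b (fun g => a fun f => x (g * f)) = x 1 then none else some (x 1))

lemma dependsOn_correctedCode [DecidableEq G] [DecidableEq K] {a : (G → K) → L} {b : (G → L) → K}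
    {F E : Finset G} (ha : DependsOn a F) (hb : DependsOn b E) :
    DependsOn (correctedCode a b) (F ∪ Finset.image₂ (· * ·) E F ∪ {1} : Finset G) := by
  intro x y hxy
  have h1 : x 1 = y 1 := hxy 1 (by simp)
  have h2 : a x = a y := ha fun i hi => hxy i (by simp [Finset.mem_coe.1 hi])
  have h3 : b (fun g => a fun f => x (g * f)) = b (fun g => a fun f => y (g * f)) :=
    hb fun g hg => ha fun f hf => hxy _ <| by
      have := Finset.mem_image₂_of_mem (f := (· * ·)) (Finset.mem_coe.1 hg) (Finset.mem_coe.1 hf)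
      simp only [Finset.coe_union, Set.mem_union, Finset.mem_coe]
      exact Or.inl (Or.inr this)
  simp only [correctedCode, h1, h2, h3]

variable [MeasurableSpace K]

theorem MeasConj.symm [MeasurableSpace L] {μ : Measure (G → K)} {ν : Measure (G → L)}
    (hshift : ∀ g : G, MeasurePreserving (shift g) μ μ) (h : MeasConj μ ν) : MeasConj ν μ := by
  obtain ⟨φ, ψ, hφ, hψ, rfl, hψφ, hφψ, hequiv⟩ := h
  have hmap : (μ.map φ).map ψ = μ := by
    rw [Measure.map_map hψ hφ, Measure.map_congr (f := ψ ∘ φ) (g := id) hψφ, Measure.map_id]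
  refine ⟨ψ, φ, hψ, hφ, hmap, hφψ, hψφ, fun g => ?_⟩
  have hx : ∀ᵐ x ∂(μ.map φ).map ψ,
      φ (shift g x) = shift g (φ x) ∧ ψ (φ (shift g x)) = shift g x := by
    rw [hmap]
    exact (hequiv g).and ((hshift g).quasiMeasurePreserving.ae hψφ)
  filter_upwards [hφψ, ae_of_ae_map hψ.aemeasurable hx] with y hy ⟨h1, h2⟩
  rw [h1, hy] at h2
  exact h2

variable [Fintype K] [MeasurableSingletonClass K]

lemma measurePreserving_mul_left_comp [Nonempty K] {κ : Measure K} {μ : Measure (G → K)}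
    (hμ : ∀ W, HasProductMarginal κ μ W) (g : G) :
    MeasurePreserving (fun (x : G → K) f => x (g * f)) μ μ := by
  classical
  refine ⟨by fun_prop, HasProductMarginal.measure_eq_measure (fun W => ?_) hμ⟩
  exact (hμ _).map_comp (mul_right_injective g).injOn

/-- The entropy of the base is at most the entropy of any code from which the Bernoulli
shift over a free group can be recovered by a finite-range correction. -/
theorem entropy_le_correctedCode {α : Type*} [Fintype L] [DecidableEq K] {κ : Measure K}
    [IsProbabilityMeasure κ] {μ : Measure (FreeGroup α → K)}
    (hμ : ∀ W, HasProductMarginal κ μ W) {a : (FreeGroup α → K) → L} {b : (FreeGroup α → L) → K}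
    {F E : Finset (FreeGroup α)} (ha : DependsOn a F) (hb : DependsOn b E) :
    ∑ k, (κ.real {k}).negMulLog ≤ ∑ c, (μ.real {x | correctedCode a b x = c}).negMulLog := by
  classical
  have : Nonempty K := nonempty_of_isProbabilityMeasure κ
  have hZ := dependsOn_correctedCode ha hb
  obtain ⟨B, π, hπ⟩ := exists_perm_hom_injOn_freeGroup (F ∪ Finset.image₂ (· * ·) E F ∪ {1})
  let P : Measure (Equiv.Perm B → K) := Measure.pi fun _ => κ
  have hP := HasProductMarginal.pi (ι := Equiv.Perm B) κ
  let θ : Equiv.Perm B → (Equiv.Perm B → K) → FreeGroup α → K := fun v x g => x (v * π g)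
  have hθ : ∀ v, Measurable (θ v) := fun v => by fun_prop
  have hsum : ∀ (p : (Equiv.Perm B → K) → Prop) [DecidablePred p],
      ∑ x with p x, P.real {x} = P.real {x | p x} := fun p _ => by
    rw [sum_measureReal_singleton, Finset.coe_filter_univ]
  refine sum_negMulLog_le_of_injective (Ω := Equiv.Perm B → K) (V := Equiv.Perm B)
    (p := fun x => P.real {x}) (S := fun v x => x v) (T := fun v x => correctedCode a b (θ v x))
    (fun x => measureReal_nonneg) ?_ (fun v k => ?_) (fun v c => ?_) (fun x => ?_) ?_
  · simp
  · rw [hsum fun x => x v = k, measureReal_def, measureReal_def]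
    have := hP {v} fun _ => k
    simp only [Finset.mem_singleton, forall_eq, Finset.prod_singleton] at this
    rw [← this]
  · rw [hsum fun x => correctedCode a b (θ v x) = c, measureReal_def, measureReal_def]
    have hmarg := (hP _).map_comp (e := fun g => v * π g)
      (S := F ∪ Finset.image₂ (· * ·) E F ∪ {1})
      fun g hg h hh hgh => hπ hg hh (mul_left_cancel hgh)
    rw [← hmarg.measure_eq (hμ _) hZ,
      Measure.map_apply (hθ v) (HasProductMarginal.measurableSet_of_dependsOn hZ c)]
    rfl
  · simp only [P, measureReal_def, Measure.pi_singleton, ENNReal.toReal_prod]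
  · intro x y hxy
    have hcode : ∀ v, correctedCode a b (θ v x) = correctedCode a b (θ v y) := congrFun hxy
    have ha' : ∀ v, a (θ v x) = a (θ v y) := fun v => congrArg Prod.fst (hcode v)
    have hθθ : ∀ v x g, (fun f => θ v x (g * f)) = θ (v * π g) x := fun v x g => by
      ext f
      simp [θ, mul_assoc]
    ext v
    have h := congrArg Prod.snd (hcode v)
    simp only [correctedCode, hθθ, ha'] at h
    have h1 : ∀ x, θ v x 1 = x v := fun x => by simp [θ]
    rw [h1, h1] at h
    split_ifs at h with hx hy hy
    · exact hx.symm.trans hy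
    · exact Option.some_injective _ h

variable [MeasurableSpace L] [Fintype L] [MeasurableSingletonClass L]

/-- The symbol of a factor map at `1` is approximated by corrected finite-range codes. -/
theorem exists_correctedCode_measure_ne_le [DecidableEq K] [Nonempty K] [Nonempty L]
    {κ : Measure K} {μ : Measure (G → K)} {ν : Measure (G → L)}
    (hμ : ∀ W, HasProductMarginal κ μ W)
    {φ : (G → K) → (G → L)} {ψ : (G → L) → (G → K)} (hφ : MeasurePreserving φ μ ν)
    (hψ : Measurable ψ) (hψφ : ∀ᵐ x ∂μ, ψ (φ x) = x)
    (hequiv : ∀ g : G, ∀ᵐ x ∂μ, φ (shift g x) = shift g (φ x)) {ε : ℝ} (hε : 0 < ε) :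
    ∃ (F E : Finset G) (a : (G → K) → L) (b : (G → L) → K), DependsOn a F ∧ DependsOn b E ∧
      μ {x | correctedCode a b x ≠ (φ x 1, none)} ≤ ENNReal.ofReal ε := by
  have := (hμ ∅).isProbabilityMeasure
  have : IsProbabilityMeasure ν := by
    rw [← hφ.map_eq]
    exact Measure.isProbabilityMeasure_map hφ.measurable.aemeasurable
  obtain ⟨E, b, hb, hbm, hbν⟩ := exists_dependsOn_measure_ne_le ν
    (f := fun y => ψ y 1) (by fun_prop) (half_pos hε)
  have hδ : 0 < ε / 2 / (E.card + 1) := by positivity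
  obtain ⟨F, a, ha, ham, haμ⟩ := exists_dependsOn_measure_ne_le μ
    (f := fun x => φ x 1) ((measurable_pi_apply 1).comp hφ.measurable) hδ
  refine ⟨F, E, a, b, ha, hb, ?_⟩
  have hφ1 : Measurable fun x => φ x 1 := (measurable_pi_apply 1).comp hφ.measurable
  have hψ1 : Measurable fun y => ψ y 1 := by fun_prop
  have hae : ∀ᵐ x ∂μ, ψ (φ x) = x ∧ ∀ g ∈ E, φ (shift g⁻¹ x) = shift g⁻¹ (φ x) :=
    hψφ.and ((Finset.eventually_all E).2 fun g _ => hequiv g⁻¹)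
  let N : G → Set (G → K) := fun g => {x | a (fun f => x (g * f)) ≠ φ (fun f => x (g * f)) 1}
  let M : Set (G → K) := {x | b (φ x) ≠ ψ (φ x) 1}
  have hN : ∀ g, μ (N g) ≤ ENNReal.ofReal (ε / 2 / (E.card + 1)) := fun g => by
    refine le_trans (le_of_eq ?_) haμ
    exact (measurePreserving_mul_left_comp hμ g).measure_preimage
      (measurableSet_eq_fun ham hφ1).compl.nullMeasurableSet
  have hM : μ M ≤ ENNReal.ofReal (ε / 2) := by
    refine le_trans (le_of_eq ?_) hbν
    exact hφ.measure_preimage (measurableSet_eq_fun hbm hψ1).compl.nullMeasurableSet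
  have hsub : ({x | correctedCode a b x ≠ (φ x 1, none)} : Set (G → K)) ≤ᵐ[μ]
      ((N 1 ∪ ⋃ g ∈ E, N g) ∪ M : Set (G → K)) := by
    filter_upwards [hae] with x ⟨hx1, hx2⟩ hx
    by_contra hcon
    replace hcon : x ∉ (N 1 ∪ ⋃ g ∈ E, N g) ∪ M := hcon
    simp only [Set.mem_union, Set.mem_iUnion, not_or, not_exists] at hcon
    obtain ⟨⟨h1, h2⟩, h3⟩ := hcon
    have h1' : a x = φ x 1 := by simpa [N] using h1
    have h2' : ∀ g ∈ E, a (fun f => x (g * f)) = φ x g := fun g hg => by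
      have e1 : a (fun f => x (g * f)) = φ (fun f => x (g * f)) 1 := not_not.1 (h2 g hg)
      have e2 : φ (fun f => x (g * f)) 1 = φ x g := by
        have h : shift g⁻¹ x = fun f => x (g * f) := by
          ext f
          rw [shift, inv_inv]
        rw [← h, hx2 g hg, shift, inv_inv, mul_one]
      exact e1.trans e2
    have h3' : b (φ x) = x 1 := by rw [not_not.1 h3, hx1]
    have h4 : b (fun g => a fun f => x (g * f)) = x 1 := (hb h2').trans h3'
    exact hx (by simp [correctedCode, h1', h4])
  have hcard : (0 : ℝ) ≤ E.card := by positivity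
  calc μ {x | correctedCode a b x ≠ (φ x 1, none)}
      ≤ μ ((N 1 ∪ ⋃ g ∈ E, N g) ∪ M) := measure_mono_ae hsub
    _ ≤ μ (N 1) + ∑ g ∈ E, μ (N g) + μ M :=
        (measure_union_le _ _).trans (add_le_add_left ((measure_union_le _ _).trans
          (add_le_add_right (measure_biUnion_finset_le _ _) _)) _)
    _ ≤ ENNReal.ofReal (ε / 2 / (E.card + 1))
          + ∑ _g ∈ E, ENNReal.ofReal (ε / 2 / (E.card + 1)) + ENNReal.ofReal (ε / 2) :=
        add_le_add (add_le_add (hN 1) (Finset.sum_le_sum fun g _ => hN g)) hM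
    _ = ENNReal.ofReal ε := by
        rw [Finset.sum_const, nsmul_eq_mul, ← ENNReal.ofReal_natCast, ← ENNReal.ofReal_mul hcard,
          ← ENNReal.ofReal_add hδ.le (by positivity), ← ENNReal.ofReal_add (by positivity)
          (by positivity)]
        congr 1
        field_simp
        ring

lemma abs_measureReal_sub_le {X A : Type*} [MeasurableSpace X] (μ : Measure X) [IsFiniteMeasure μ]
    (Z Z' : X → A) (c : A) :
    |μ.real {x | Z x = c} - μ.real {x | Z' x = c}| ≤ μ.real {x | Z x ≠ Z' x} := by
  have key : ∀ Y Y' : X → A,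
      μ.real {x | Y x = c} ≤ μ.real {x | Y' x = c} + μ.real {x | Y x ≠ Y' x} := fun Y Y' =>
    (measureReal_mono fun x (hx : Y x = c) => by
      by_cases h : Y x = Y' x
      · exact Or.inl (h.symm.trans hx)
      · exact Or.inr h).trans (measureReal_union_le _ _)
  have h1 := key Z Z'
  have h2 := key Z' Z
  simp only [fun x => ne_comm (a := Z' x) (b := Z x)] at h2
  rw [abs_le]
  constructor <;> linarith

theorem entropy_le_of_conj {α : Type*} {κ : Measure K} [IsProbabilityMeasure κ]
    {τ : Measure L} [IsProbabilityMeasure τ]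
    {μ : Measure (FreeGroup α → K)} {ν : Measure (FreeGroup α → L)}
    (hμ : ∀ W, HasProductMarginal κ μ W) (hν : ∀ W, HasProductMarginal τ ν W)
    (hconj : MeasConj μ ν) :
    ∑ k, (κ.real {k}).negMulLog ≤ ∑ l, (τ.real {l}).negMulLog := by
  classical
  have : Nonempty K := nonempty_of_isProbabilityMeasure κ
  have : Nonempty L := nonempty_of_isProbabilityMeasure τ
  have := (hμ ∅).isProbabilityMeasure
  obtain ⟨φ, ψ, hφ, hψ, hmap, hψφ, -, hequiv⟩ := hconj
  choose F E a b ha hb hab using fun n : ℕ => exists_correctedCode_measure_ne_le hμ ⟨hφ, hmap⟩ hψ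
    hψφ hequiv (ε := 1 / ((n : ℝ) + 1)) (by positivity)
  have hlim : ∀ c : L × Option K,
      Filter.Tendsto (fun n => μ.real {x | correctedCode (a n) (b n) x = c}) Filter.atTop
        (nhds (μ.real {x | (φ x 1, (none : Option K)) = c})) := fun c => by
    rw [tendsto_iff_norm_sub_tendsto_zero]
    refine squeeze_zero (fun _ => norm_nonneg _) (fun n => ?_)
      tendsto_one_div_add_atTop_nhds_zero_nat
    exact (abs_measureReal_sub_le μ _ _ c).trans
      (ENNReal.toReal_le_of_le_ofReal (by positivity) (hab n))
  have hle := ge_of_tendsto' (tendsto_finsetSum Finset.univ fun c _ =>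
    (Real.continuous_negMulLog.tendsto _).comp (hlim c))
    fun n => entropy_le_correctedCode hμ (ha n) (hb n)
  refine hle.trans_eq ?_
  rw [Fintype.sum_prod_type]
  refine Finset.sum_congr rfl fun l _ => ?_
  have hl : μ.real {x | φ x 1 = l} = τ.real {l} := by
    have h := hν {1} fun _ => l
    simp only [Finset.mem_singleton, forall_eq, Finset.prod_singleton] at h
    have hm : MeasurableSet {y : FreeGroup α → L | y 1 = l} :=
      measurableSet_eq_fun (measurable_pi_apply 1) measurable_const
    rw [measureReal_def, measureReal_def, ← h, ← hmap, Measure.map_apply hφ hm]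
    rfl
  simp [Fintype.sum_option, hl]

end

end Bowen

open Bowen

/-- two Bernoulli shifts over a finitely generated free group are measurably
conjugate only if their base measures have equal entropy `H(κ) = -∑ κ{k} log κ{k}`.
(The product measures `κᵢ^G` are characterized by their values on cylinder sets.) -/
theorem bernoulli_conjugate_entropy {r : ℕ} {K₁ K₂ : Type*} [Fintype K₁] [Fintype K₂]
    [MeasurableSpace K₁] [MeasurableSingletonClass K₁]
    [MeasurableSpace K₂] [MeasurableSingletonClass K₂]
    (κ₁ : Measure K₁) [IsProbabilityMeasure κ₁]
    (κ₂ : Measure K₂) [IsProbabilityMeasure κ₂]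
    (μ₁ : Measure (FreeGroup (Fin r) → K₁)) (μ₂ : Measure (FreeGroup (Fin r) → K₂))
    (hcyl₁ : ∀ (F : Finset (FreeGroup (Fin r))) (y : FreeGroup (Fin r) → K₁),
      μ₁ {x | ∀ g ∈ F, x g = y g} = ∏ g ∈ F, κ₁ {y g})
    (hcyl₂ : ∀ (F : Finset (FreeGroup (Fin r))) (y : FreeGroup (Fin r) → K₂),
      μ₂ {x | ∀ g ∈ F, x g = y g} = ∏ g ∈ F, κ₂ {y g})
    (hconj : MeasConj μ₁ μ₂) :
    ∑' k : K₁, Real.negMulLog (κ₁ {k}).toReal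
      = ∑' k : K₂, Real.negMulLog (κ₂ {k}).toReal := by
  have h₁ : Nonempty K₁ := nonempty_of_isProbabilityMeasure κ₁
  simp only [tsum_fintype]
  exact (entropy_le_of_conj hcyl₁ hcyl₂ hconj).antisymm
    (entropy_le_of_conj hcyl₂ hcyl₁
      (hconj.symm fun g => measurePreserving_mul_left_comp hcyl₁ g⁻¹))
end
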